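/- Let s = diag(μ₁·I_{n₁}, …, μ_m·I_{n_m}) be a diagonalizable automorphism of an (ℓ+1)-dimensional vector space W (ℓ ≥ 1) over an algebraically closed field of characteristic ≠ 2, with the μ_i pairwise distinct, det(s)=1, and s not a scalar. Then every eigenspace of the induced action of s on the symmetric square Sym²(W) has dimension at most (ℓ² + ℓ + 2)/2, with equality if and only if, up to conjugation, s = diag(d,…,d,d^{−ℓ}) with d^{ℓ+1} = −1 and the eigenvalue is d². -/

import Mathlib

open TensorProduct

/-- The symmetric square of `W`, realised (for `char k ≠ 2`) as the submodule of `W ⊗ W`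
spanned by the squares `x ⊗ x`. -/
noncomputable def symSq (k W : Type*) [Field k] [AddCommGroup W] [Module k W] :
    Submodule k (W ⊗[k] W) :=
  Submodule.span k {z | ∃ x : W, z = x ⊗ₜ[k] x}

open Module

section SymmetricSquare

variable {k W ι : Type*} [Field k] [AddCommGroup W] [Module k W]

lemma tmul_add_tmul_swap_mem_symSq (u v : W) : u ⊗ₜ[k] v + v ⊗ₜ[k] u ∈ symSq k W := by
  have h : u ⊗ₜ[k] v + v ⊗ₜ[k] u = (u + v) ⊗ₜ[k] (u + v) - u ⊗ₜ[k] u - v ⊗ₜ[k] v := by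
    simp only [TensorProduct.add_tmul, TensorProduct.tmul_add]; abel
  rw [h]
  exact Submodule.sub_mem _ (Submodule.sub_mem _ (Submodule.subset_span ⟨_, rfl⟩)
    (Submodule.subset_span ⟨_, rfl⟩)) (Submodule.subset_span ⟨_, rfl⟩)

lemma mem_symSq_iff [Fintype ι] (hk2 : (2 : k) ≠ 0) (b : Basis ι k W) (x : W ⊗[k] W) :
    x ∈ symSq k W ↔
      ∀ i j, (b.tensorProduct b).repr x (i, j) = (b.tensorProduct b).repr x (j, i) := by
  constructor
  · intro hx i j
    induction hx using Submodule.span_induction with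
    | mem x hx => obtain ⟨w, rfl⟩ := hx; simp [mul_comm]
    | zero => simp
    | add x y _ _ hx hy => simp [hx, hy]
    | smul a x _ hx => simp [hx]
  · intro h
    have hx : x = ∑ p : ι × ι, (b.tensorProduct b).repr x p • (b p.1 ⊗ₜ[k] b p.2) := by
      conv_lhs => rw [← (b.tensorProduct b).sum_repr x]
      simp [Basis.tensorProduct_apply']
    have hx' : x = ∑ p : ι × ι, (b.tensorProduct b).repr x p • (b p.2 ⊗ₜ[k] b p.1) := by
      conv_lhs => rw [hx]
      rw [← Equiv.sum_comp (Equiv.prodComm ι ι)]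
      exact Finset.sum_congr rfl fun ⟨i, j⟩ _ => by simp [h j i]
    have h2 : (2 : k) • x ∈ symSq k W := by
      rw [two_smul]
      nth_rw 1 [hx]
      nth_rw 2 [hx']
      rw [← Finset.sum_add_distrib]
      refine Submodule.sum_mem _ fun p _ => ?_
      rw [← smul_add]
      exact Submodule.smul_mem _ _ (tmul_add_tmul_swap_mem_symSq _ _)
    exact (Submodule.smul_mem_iff _ hk2).1 h2

lemma repr_apply_of_eigenbasis (b : Basis ι k W) (s : W →ₗ[k] W) (ν : ι → k)
    (hs : ∀ i, s (b i) = ν i • b i) (w : W) (i : ι) : b.repr (s w) i = ν i * b.repr w i := by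
  have h : b.coord i ∘ₗ s = ν i • b.coord i := by
    refine b.ext fun j => ?_
    by_cases hij : j = i
    · subst hij; simp [hs]
    · simp [hs, hij]
  simpa using LinearMap.congr_fun h w

lemma repr_map_of_eigenbasis (b : Basis ι k W) (s : W →ₗ[k] W) (ν : ι → k)
    (hs : ∀ i, s (b i) = ν i • b i) (x : W ⊗[k] W) (i j : ι) :
    (b.tensorProduct b).repr (TensorProduct.map s s x) (i, j) =
      ν i * ν j * (b.tensorProduct b).repr x (i, j) := by
  induction x with
  | zero => simp
  | tmul u v => simp [repr_apply_of_eigenbasis b s ν hs]; ring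
  | add x y hx hy => simp [hx, hy]; ring

lemma mem_eigenspace_map_iff (b : Basis ι k W) (s : W →ₗ[k] W) (ν : ι → k)
    (hs : ∀ i, s (b i) = ν i • b i) (c : k) (x : W ⊗[k] W) :
    x ∈ End.eigenspace (TensorProduct.map s s) c ↔
      ∀ i j, ν i * ν j ≠ c → (b.tensorProduct b).repr x (i, j) = 0 := by
  rw [End.mem_eigenspace_iff, (b.tensorProduct b).ext_elem_iff]
  simp only [Prod.forall, repr_map_of_eigenbasis b s ν hs, map_smul, Finsupp.smul_apply,
    smul_eq_mul]
  refine forall₂_congr fun i j => ?_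
  rw [mul_eq_mul_right_iff]
  tauto

lemma finrank_eigenspace_map_inf_symSq [Fintype ι] [LinearOrder ι] [DecidableEq k]
    (hk2 : (2 : k) ≠ 0) (b : Basis ι k W) (s : W →ₗ[k] W) (ν : ι → k)
    (hs : ∀ i, s (b i) = ν i • b i) (c : k) :
    finrank k ↥(End.eigenspace (TensorProduct.map s s) c ⊓ symSq k W) =
      Fintype.card {p : ι × ι // p.1 ≤ p.2 ∧ ν p.1 * ν p.2 = c} := by
  set V := End.eigenspace (TensorProduct.map s s) c ⊓ symSq k W
  let B := b.tensorProduct b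
  have hV : ∀ x, x ∈ V ↔ (∀ i j, ν i * ν j ≠ c → B.repr x (i, j) = 0) ∧
      ∀ i j, B.repr x (i, j) = B.repr x (j, i) := fun x =>
    and_congr (mem_eigenspace_map_iff b s ν hs c x) (mem_symSq_iff hk2 b x)
  let f : V →ₗ[k] ({p : ι × ι // p.1 ≤ p.2 ∧ ν p.1 * ν p.2 = c} → k) :=
    LinearMap.pi fun p => B.coord p.1 ∘ₗ V.subtype
  have hf : Function.Bijective f := by
    constructor
    · rw [← LinearMap.ker_eq_bot, LinearMap.ker_eq_bot']
      rintro ⟨x, hx⟩ h0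
      obtain ⟨he, hsymm⟩ := (hV x).1 hx
      have hle : ∀ i j, i ≤ j → B.repr x (i, j) = 0 := fun i j hij => by
        by_cases hc : ν i * ν j = c
        · exact congrFun h0 ⟨(i, j), hij, hc⟩
        · exact he i j hc
      ext1
      refine B.ext_elem fun p => ?_
      rcases le_total p.1 p.2 with h | h
      · simpa using hle _ _ h
      · simpa [hsymm p.1 p.2] using hle _ _ h
    · intro g
      let G : ι × ι → k := fun p =>
        if h : p.1 ≤ p.2 ∧ ν p.1 * ν p.2 = c then g ⟨p, h⟩ else 0
      let F : ι × ι → k := fun p => G (min p.1 p.2, max p.1 p.2)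
      let x := B.equivFun.symm F
      have hx : ∀ p, B.repr x p = F p := fun p => by
        rw [← B.equivFun_apply, LinearEquiv.apply_symm_apply]
      have hxV : x ∈ V := by
        refine (hV x).2 ⟨fun i j hij => ?_, fun i j => ?_⟩
        · rw [hx]
          refine dif_neg fun h => hij ?_
          rw [← h.2]
          rcases le_total i j with h | h <;> simp [h, mul_comm]
        · rw [hx, hx]; simp only [F, min_comm, max_comm]
      refine ⟨⟨x, hxV⟩, funext fun ⟨p, hp⟩ => ?_⟩
      change B.repr x p = _
      rw [hx]
      simp [F, G, hp.1, hp.2]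
  rw [(LinearEquiv.ofBijective f hf).finrank_eq, finrank_fintype_fun_eq_card]

end SymmetricSquare

section Counting

variable {k ι : Type*} [Field k] [DecidableEq k] [Fintype ι] [LinearOrder ι]

lemma two_mul_card_le_mul_eq (ν : ι → k) (c : k) :
    2 * Fintype.card {p : ι × ι // p.1 ≤ p.2 ∧ ν p.1 * ν p.2 = c} =
      (Finset.univ.filter fun p : ι × ι => ν p.1 * ν p.2 = c).card +
        (Finset.univ.filter fun i => ν i * ν i = c).card := by
  have hswap : (Finset.univ.filter fun p : ι × ι => p.2 ≤ p.1 ∧ ν p.1 * ν p.2 = c).card =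
      (Finset.univ.filter fun p : ι × ι => p.1 ≤ p.2 ∧ ν p.1 * ν p.2 = c).card :=
    Finset.card_equiv (Equiv.prodComm ι ι) (by simp [mul_comm])
  have hdiag : (Finset.univ.filter fun i => ν i * ν i = c).card =
      ((Finset.univ.filter fun p : ι × ι => p.1 ≤ p.2 ∧ ν p.1 * ν p.2 = c) ∩
        (Finset.univ.filter fun p : ι × ι => p.2 ≤ p.1 ∧ ν p.1 * ν p.2 = c)).card := by
    refine Finset.card_bij (fun i _ => (i, i)) (by simp) (by simp) ?_
    rintro ⟨i, j⟩ h
    simp only [Finset.mem_inter, Finset.mem_filter, Finset.mem_univ, true_and] at h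
    obtain rfl := le_antisymm h.1.1 h.2.1
    exact ⟨i, by simpa using h.1.2, rfl⟩
  have hunion : (Finset.univ.filter fun p : ι × ι => ν p.1 * ν p.2 = c) =
      (Finset.univ.filter fun p : ι × ι => p.1 ≤ p.2 ∧ ν p.1 * ν p.2 = c) ∪
        (Finset.univ.filter fun p : ι × ι => p.2 ≤ p.1 ∧ ν p.1 * ν p.2 = c) := by
    ext p
    have := le_total p.1 p.2
    simp only [Finset.mem_union, Finset.mem_filter, Finset.mem_univ, true_and]
    tauto
  rw [hdiag, hunion, Finset.card_union_add_card_inter, hswap, Fintype.card_subtype]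
  ring

lemma two_mul_card_le_mul_eq_sq (hk2 : (2 : k) ≠ 0) (ν : ι → k) {a : k} (ha : a ≠ 0) {p q r : ℕ}
    (hp : (Finset.univ.filter fun i => ν i = a).card = p)
    (hq : (Finset.univ.filter fun i => ν i = -a).card = q)
    (hr : (Finset.univ.filter fun i => ¬(ν i = a ∨ ν i = -a)).card = r) :
    p + q + r = Fintype.card ι ∧
    2 * Fintype.card {x : ι × ι // x.1 ≤ x.2 ∧ ν x.1 * ν x.2 = a ^ 2} + r ≤
      p ^ 2 + q ^ 2 + r ^ 2 + p + q ∧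
    (r = 0 → 2 * Fintype.card {x : ι × ι // x.1 ≤ x.2 ∧ ν x.1 * ν x.2 = a ^ 2} =
      p ^ 2 + q ^ 2 + p + q) := by
  have hneg : a ≠ -a := fun h => by
    have : 2 * a = 0 := by linear_combination h
    exact (mul_ne_zero hk2 ha) this
  have hsq (i : ι) : ν i * ν i = a ^ 2 ↔ ν i = a ∨ ν i = -a := by
    rw [← sq, sq_eq_sq_iff_eq_or_eq_neg]
  rw [two_mul_card_le_mul_eq]
  have hdisj : Disjoint (Finset.univ.filter fun i => ν i = a)
      (Finset.univ.filter fun i => ν i = -a) :=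
    Finset.disjoint_filter.2 fun i _ h h' => hneg (h.symm.trans h')
  have hD : (Finset.univ.filter fun i => ν i * ν i = a ^ 2).card = p + q := by
    simp only [hsq]
    rw [Finset.filter_or, Finset.card_union_of_disjoint hdisj, hp, hq]
  have hL : p + q + r = Fintype.card ι := by
    rw [← hD, ← hr]
    simp only [hsq]
    exact Finset.card_filter_add_card_filter_not _
  set P := Finset.univ.filter fun i => ν i = a
  set Q := Finset.univ.filter fun i => ν i = -a
  set R := Finset.univ.filter fun i => ¬(ν i = a ∨ ν i = -a) with hR
  have hsub : (Finset.univ.filter fun x : ι × ι => ν x.1 * ν x.2 = a ^ 2) ⊆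
      P ×ˢ P ∪ Q ×ˢ Q ∪ R.offDiag := by
    rintro ⟨i, j⟩ hij
    simp only [Finset.mem_filter, Finset.mem_univ, true_and] at hij
    simp only [P, Q, R, Finset.mem_union, Finset.mem_product, Finset.mem_offDiag,
      Finset.mem_filter, Finset.mem_univ, true_and]
    have key : ∀ u v : k, u * v = a ^ 2 → (u = a → v = a) ∧ (u = -a → v = -a) := by
      refine fun u v huv => ⟨?_, ?_⟩ <;> rintro rfl <;> apply mul_left_cancel₀ ha
      · linear_combination huv
      · linear_combination -huv
    have h1 := key _ _ hij
    have h2 := key (ν j) (ν i) (by rw [mul_comm, hij])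
    have h3 : i = j → ν i = a ∨ ν i = -a := by
      rintro rfl; exact (hsq i).1 hij
    tauto
  have hdisj' : Disjoint (P ×ˢ P) (Q ×ˢ Q) := Finset.disjoint_product.2 (Or.inl hdisj)
  have hcard : (P ×ˢ P ∪ Q ×ˢ Q).card = p ^ 2 + q ^ 2 := by
    rw [Finset.card_union_of_disjoint hdisj', Finset.card_product, Finset.card_product, hp, hq,
      sq, sq]
  refine ⟨hL, ?_, fun hr0 => ?_⟩
  · have h1 := (Finset.card_le_card hsub).trans (Finset.card_union_le _ _)
    rw [hcard, Finset.offDiag_card, hr] at h1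
    have : r ≤ r * r := Nat.le_mul_self r
    rw [hD, sq r]
    lia
  · have hR0 : R = ∅ := Finset.card_eq_zero.1 (hr.trans hr0)
    have heq : (Finset.univ.filter fun x : ι × ι => ν x.1 * ν x.2 = a ^ 2) =
        P ×ˢ P ∪ Q ×ˢ Q := by
      refine Finset.Subset.antisymm (by simpa [hR0] using hsub) ?_
      rintro ⟨i, j⟩ hij
      simp only [P, Q, Finset.mem_union, Finset.mem_product, Finset.mem_filter, Finset.mem_univ,
        true_and] at hij ⊢
      rcases hij with ⟨h, h'⟩ | ⟨h, h'⟩ <;> rw [h, h'] <;> ring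
    rw [heq, hcard, hD]
    ring

lemma card_le_mul_eq_zero (ν : ι → k) (hν : ∀ i, ν i ≠ 0) :
    Fintype.card {x : ι × ι // x.1 ≤ x.2 ∧ ν x.1 * ν x.2 = 0} = 0 :=
  Fintype.card_eq_zero_iff.2 ⟨fun x => mul_ne_zero (hν _) (hν _) x.2.2⟩

lemma sq_add_sq_add_sq_add_le {p q r : ℕ} (hp : 0 < q + r) (hq : 0 < p + r) :
    p ^ 2 + q ^ 2 + r ^ 2 + p + q + (p + q) ≤ (p + q + r) ^ 2 + 2 ∧
    (p ^ 2 + q ^ 2 + r ^ 2 + p + q + (p + q) = (p + q + r) ^ 2 + 2 →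
      r = 0 ∧ (p = 1 ∨ q = 1)) := by
  rcases Nat.eq_zero_or_pos r with rfl | hr
  · obtain ⟨p, rfl⟩ : ∃ p', p = p' + 1 := ⟨p - 1, by lia⟩
    obtain ⟨q, rfl⟩ : ∃ q', q = q' + 1 := ⟨q - 1, by lia⟩
    refine ⟨by nlinarith [Nat.zero_le (p * q)], fun h => ⟨rfl, ?_⟩⟩
    have : p * q = 0 := by nlinarith
    simpa using this
  · obtain ⟨r, rfl⟩ : ∃ r', r = r' + 1 := ⟨r - 1, by lia⟩
    have : p ^ 2 + q ^ 2 + (r + 1) ^ 2 + p + q + (p + q) < (p + q + (r + 1)) ^ 2 + 2 := by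
      nlinarith [Nat.zero_le (p * q), Nat.zero_le (p * r), Nat.zero_le (q * r)]
    exact ⟨this.le, fun h => absurd h this.ne⟩

lemma two_mul_card_add_card_le (hk2 : (2 : k) ≠ 0) (ν : ι → k) {a : k} (ha : a ≠ 0)
    (hconst : ∀ c, ∃ i, ν i ≠ c) :
    2 * Fintype.card {x : ι × ι // x.1 ≤ x.2 ∧ ν x.1 * ν x.2 = a ^ 2} + Fintype.card ι ≤
      Fintype.card ι ^ 2 + 2 ∧
    (2 * Fintype.card {x : ι × ι // x.1 ≤ x.2 ∧ ν x.1 * ν x.2 = a ^ 2} + Fintype.card ι =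
      Fintype.card ι ^ 2 + 2 → (∀ i, ν i = a ∨ ν i = -a) ∧
        ((Finset.univ.filter fun i => ν i = a).card = 1 ∨
          (Finset.univ.filter fun i => ν i = -a).card = 1)) := by
  obtain ⟨hL, hle, -⟩ := two_mul_card_le_mul_eq_sq hk2 ν ha rfl rfl rfl
  have hlt (c : k) : (Finset.univ.filter fun i => ν i = c).card < Fintype.card ι := by
    obtain ⟨i, hi⟩ := hconst c
    exact Finset.card_lt_univ_of_notMem (x := i) (by simpa using hi)
  have hp := hlt a
  have hq := hlt (-a)
  obtain ⟨h1, h2⟩ := sq_add_sq_add_sq_add_le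
    (p := (Finset.univ.filter fun i => ν i = a).card)
    (q := (Finset.univ.filter fun i => ν i = -a).card)
    (r := (Finset.univ.filter fun i => ¬(ν i = a ∨ ν i = -a)).card) (by lia) (by lia)
  rw [hL] at h1 h2
  refine ⟨by lia, fun h => ?_⟩
  obtain ⟨h3, h4⟩ := h2 (by lia)
  refine ⟨fun i => ?_, h4⟩
  exact not_not.1 <| Finset.filter_eq_empty_iff.1 (Finset.card_eq_zero.1 h3) (Finset.mem_univ i)

end Counting

section Eigenbasis

variable {k W : Type*} [Field k] [AddCommGroup W] [Module k W]

lemma exists_eigenbasis [FiniteDimensional k W] {m : ℕ} {μ : Fin m → k} {n : Fin m → ℕ}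
    (hμ : Function.Injective μ) (s : W →ₗ[k] W)
    (heig : ∀ i, finrank k (End.eigenspace s (μ i)) = n i)
    (hdiag : (⨆ i, End.eigenspace s (μ i)) = ⊤) :
    ∃ b : Basis (Σ i, Fin (n i)) k W, ∀ x, s (b x) = μ x.1 • b x := by
  have hint := DirectSum.isInternal_submodule_of_iSupIndep_of_iSup_eq_top
    ((End.eigenspaces_iSupIndep s).comp hμ) hdiag
  refine ⟨hint.collectedBasis fun i => finBasisOfFinrankEq k _ (heig i), fun x => ?_⟩
  exact End.mem_eigenspace_iff.1 (hint.collectedBasis_mem _ x)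

lemma det_of_eigenbasis {ι : Type*} [Fintype ι] [DecidableEq ι] (b : Basis ι k W)
    (s : W →ₗ[k] W) (ν : ι → k) (hs : ∀ i, s (b i) = ν i • b i) :
    LinearMap.det s = ∏ i, ν i := by
  have h : LinearMap.toMatrix b b s = Matrix.diagonal ν := by
    ext i j
    by_cases hij : i = j
    · subst hij; simp [LinearMap.toMatrix_apply, hs]
    · simp [LinearMap.toMatrix_apply, hs, hij]
  rw [← LinearMap.det_toMatrix b, h, Matrix.det_diagonal]

end Eigenbasis

lemma card_filter_sigma_fst {k : Type*} [DecidableEq k] {m : ℕ} {μ : Fin m → k} (n : Fin m → ℕ)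
    (hμ : Function.Injective μ) (i : Fin m) :
    (Finset.univ.filter fun x : Σ i, Fin (n i) => μ x.1 = μ i).card = n i := by
  have h : (Finset.univ.filter fun x : Σ i, Fin (n i) => μ x.1 = μ i) =
      Finset.univ.map (Function.Embedding.sigmaMk (β := fun i => Fin (n i)) i) := by
    ext ⟨j, y⟩
    simp only [Finset.mem_filter, Finset.mem_univ, true_and, hμ.eq_iff, Finset.mem_map]
    constructor
    · rintro rfl; exact ⟨y, rfl⟩
    · rintro ⟨y, hy⟩
      exact (congrArg Sigma.fst hy).symm
  rw [h, Finset.card_map, Finset.card_univ, Fintype.card_fin]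

/-- Let `s = diag(μ₁·I_{n₁}, …, μ_m·I_{n_m})` be a diagonalizable
automorphism of an `(ℓ+1)`-dimensional space `W` (`ℓ ≥ 1`) over an algebraically closed
field of characteristic `≠ 2`, with pairwise distinct `μ_i`, `det s = 1` and `s` not a
scalar (`m ≥ 2`).  Then every eigenspace of the induced action of `s` on `Sym²(W)` has
dimension at most `(ℓ² + ℓ + 2)/2`, with equality if and only if, up to conjugation,
`s = diag(d,…,d,d^{−ℓ})` with `d^{ℓ+1} = −1` and the eigenvalue is `d²`. -/
theorem stmt3 {k : Type*} [Field k] [IsAlgClosed k] (hk2 : (2 : k) ≠ 0)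
    {W : Type*} [AddCommGroup W] [Module k W] [FiniteDimensional k W]
    (ℓ : ℕ) (hl : 1 ≤ ℓ) (hW : Module.finrank k W = ℓ + 1)
    (m : ℕ) (hm : 2 ≤ m) (μ : Fin m → k) (n : Fin m → ℕ)
    (hμ : Function.Injective μ) (hmono : Antitone n) (hn : ∀ i, 1 ≤ n i)
    (hsum : ∑ i, n i = ℓ + 1)
    (s : W →ₗ[k] W) (hdet : LinearMap.det s = 1)
    (heig : ∀ i, Module.finrank k (Module.End.eigenspace s (μ i)) = n i)
    (hdiag : (⨆ i, Module.End.eigenspace s (μ i)) = ⊤) :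
    ∀ μ0 : k,
      Module.finrank k
        ↥(Module.End.eigenspace (TensorProduct.map s s) μ0 ⊓ symSq k W) ≤
        (ℓ ^ 2 + ℓ + 2) / 2 ∧
      (Module.finrank k
          ↥(Module.End.eigenspace (TensorProduct.map s s) μ0 ⊓ symSq k W) =
          (ℓ ^ 2 + ℓ + 2) / 2 ↔
        ∃ d : k, d ^ (ℓ + 1) = -1 ∧ μ0 = d ^ 2 ∧ m = 2 ∧
          μ ⟨0, by omega⟩ = d ∧ n ⟨0, by omega⟩ = ℓ ∧
          μ ⟨1, by omega⟩ = d⁻¹ ^ ℓ ∧ n ⟨1, by omega⟩ = 1) := by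
  classical
  intro μ0
  obtain ⟨b, hb⟩ := exists_eigenbasis hμ s heig hdiag
  let : LinearOrder (Σ i, Fin (n i)) :=
    LinearOrder.lift' (Fintype.equivFin (Σ i, Fin (n i))) (Equiv.injective _)
  have hcard : Fintype.card (Σ i, Fin (n i)) = ℓ + 1 := by
    rw [← hW, finrank_eq_card_basis b]
  have hprod : ∏ i, μ i ^ n i = 1 := by
    rw [← hdet, det_of_eigenbasis b s _ hb, Fintype.prod_sigma]
    simp
  have hμ_ne (i : Fin m) : μ i ≠ 0 := fun h => by
    refine one_ne_zero (hprod.symm.trans (Finset.prod_eq_zero (Finset.mem_univ i) ?_))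
    rw [h, zero_pow (by have := hn i; lia)]
  have hconst (c : k) : ∃ x : Σ i, Fin (n i), μ x.1 ≠ c := by
    by_contra! h
    have h01 : (⟨0, by lia⟩ : Fin m) = ⟨1, by lia⟩ :=
      hμ ((h ⟨_, ⟨0, hn _⟩⟩).trans (h ⟨_, ⟨0, hn _⟩⟩).symm)
    simp at h01
  rw [finrank_eigenspace_map_inf_symSq hk2 b s _ hb]
  have hfib := card_filter_sigma_fst n hμ
  have heven : 2 * ((ℓ ^ 2 + ℓ + 2) / 2) = ℓ ^ 2 + ℓ + 2 := by
    have := Nat.even_mul_succ_self ℓ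
    refine Nat.mul_div_cancel' (even_iff_two_dvd.1 ?_)
    rw [show ℓ ^ 2 + ℓ + 2 = ℓ * (ℓ + 1) + 2 by ring]
    exact this.add even_two
  have hsq : (ℓ + 1) ^ 2 + 2 = ℓ ^ 2 + ℓ + 2 + (ℓ + 1) := by ring
  obtain ⟨a, rfl⟩ := IsAlgClosed.exists_pow_nat_eq μ0 two_pos
  rcases eq_or_ne a 0 with rfl | ha
  · rw [zero_pow two_ne_zero, card_le_mul_eq_zero _ fun _ => hμ_ne _]
    refine ⟨Nat.zero_le _, fun h => by lia, ?_⟩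
    rintro ⟨d, hd, h0, -⟩
    rw [pow_eq_zero_iff two_ne_zero |>.1 h0.symm] at hd
    simp at hd
  obtain ⟨hle, heq⟩ := two_mul_card_add_card_le hk2 (fun x : Σ i, Fin (n i) => μ x.1) ha hconst
  rw [hcard, hsq] at hle heq
  refine ⟨by lia, fun h => ?_, ?_⟩
  · obtain ⟨hall, hone⟩ := heq (by lia)
    have hall' (i : Fin m) : μ i = a ∨ μ i = -a := hall ⟨i, ⟨0, hn i⟩⟩
    obtain rfl : m = 2 := by
      by_contra hm2
      have h01 := hμ.ne (a₁ := ⟨0, by lia⟩) (a₂ := ⟨1, by lia⟩) (by simp)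
      have h02 := hμ.ne (a₁ := ⟨0, by lia⟩) (a₂ := ⟨2, by lia⟩) (by simp)
      have h12 := hμ.ne (a₁ := ⟨1, by lia⟩) (a₂ := ⟨2, by lia⟩) (by simp)
      have h0 := hall' ⟨0, by lia⟩
      have h1 := hall' ⟨1, by lia⟩
      have h2 := hall' ⟨2, by lia⟩
      grind
    change ∃ d : k, _ ∧ _ ∧ _ ∧ μ 0 = d ∧ n 0 = ℓ ∧ μ 1 = _ ∧ n 1 = 1
    have hle01 : n 1 ≤ n 0 := hmono (by simp)
    have hsum01 : n 0 + n 1 = ℓ + 1 := by rw [← hsum, Fin.sum_univ_two]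
    have h01 : μ 0 ≠ μ 1 := hμ.ne (by simp)
    have hsq0 : a ^ 2 = μ 0 ^ 2 := by rcases hall' 0 with h | h <;> rw [h] <;> ring
    have hneg : μ 1 = -μ 0 := by
      obtain ⟨h | h, h' | h'⟩ := And.intro (hall' 0) (hall' 1)
      · exact absurd (h.trans h'.symm) h01
      · rw [h, h']
      · rw [h, h', neg_neg]
      · exact absurd (h.trans h'.symm) h01
    have hn01 : n 0 = 1 ∨ n 1 = 1 := by
      rw [← hfib 0, ← hfib 1, hneg]
      rcases hall' 0 with h | h
      · rwa [h]
      · rw [h, neg_neg]; exact hone.symm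
    have hn1 : n 1 = 1 := by have := hn 1; lia
    have hn0 : n 0 = ℓ := by lia
    rw [Fin.prod_univ_two, hn0, hn1, pow_one] at hprod
    refine ⟨μ 0, ?_, hsq0, rfl, rfl, hn0, ?_, hn1⟩
    · rw [hneg] at hprod
      linear_combination -hprod
    · rw [inv_pow]
      exact eq_inv_of_mul_eq_one_right hprod
  · rintro ⟨d, hd, had, rfl, h0, hn0, h1, hn1⟩
    change μ 0 = d at h0
    change n 0 = ℓ at hn0
    change n 1 = 1 at hn1
    change μ 1 = _ at h1
    have hd0 : d ≠ 0 := h0 ▸ hμ_ne 0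
    have h1' : μ 1 = -d := by
      rw [h1, inv_pow, inv_eq_iff_eq_inv, inv_neg, eq_neg_iff_add_eq_zero]
      field_simp
      linear_combination hd
    rw [had]
    have hall (x : Σ i, Fin (n i)) : μ x.1 = d ∨ μ x.1 = -d := by
      rcases x with ⟨i, x⟩
      fin_cases i
      · exact Or.inl h0
      · exact Or.inr h1'
    have h := (two_mul_card_le_mul_eq_sq hk2 (fun x : Σ i, Fin (n i) => μ x.1) hd0
      (h0 ▸ hfib 0) (h1' ▸ hfib 1) rfl).2.2 (by simp [hall])
    rw [hn0, hn1] at h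
    lia
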